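/- arXiv:1201.1064 — 3 statements merged into one kernel-verified Lean document; each statement's English description precedes it below -/
import Mathlib

section
/- One-step error recursion for the parareal algorithm. Under hypotheses (H2)–(H4), for all indices i, j, n with i + 1 ≤ M, the parareal iterates satisfy ‖Y_{n+1}^{j+1} − y(T_{n+1})‖_i ≤ (1 + CΔT)‖Y_n^{j+1} − y(T_n)‖_i + CΔT·ε·‖Y_n^j − y(T_n)‖_{i+1} + CΔT·η·‖Y_n^j − y(T_n)‖_{i+1} + CΔT·η·‖y(T_n)‖_{i+1}. -/
/-- One-step error recursion for the parareal algorithm: under hypotheses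
(H2)-(H4), `‖Y_{n+1}^{j+1} − y(T_{n+1})‖_i ≤ (1 + CΔT)‖Y_n^{j+1} − y(T_n)‖_i
+ CΔTε‖Y_n^j − y(T_n)‖_{i+1} + CΔTη‖Y_n^j − y(T_n)‖_{i+1} + CΔTη‖y(T_n)‖_{i+1}`. -/
theorem parareal_one_step_error_recursion
    {B : Type*} [AddCommGroup B] [Module ℝ B]
    (M : ℕ) (nrm : ℕ → B → ℝ)
    (hnrm_nonneg : ∀ j ≤ M, ∀ x : B, 0 ≤ nrm j x)
    (hnrm_add : ∀ j ≤ M, ∀ x y : B, nrm j (x + y) ≤ nrm j x + nrm j y)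
    (hnrm_smul : ∀ j ≤ M, ∀ (a : ℝ) (x : B), nrm j (a • x) = |a| * nrm j x)
    (hnrm_def : ∀ j ≤ M, ∀ x : B, nrm j x = 0 → x = 0)
    (hnrm_mono : ∀ j, j + 1 ≤ M → ∀ x : B, nrm j x ≤ nrm (j + 1) x)
    -- time grid
    (T : ℝ) (hT : 0 < T) (N : ℕ) (hN : 0 < N)
    (ΔT : ℝ) (hΔT : ΔT = T / N)
    (Tg : ℕ → ℝ) (hTg : ∀ n, Tg n = (n : ℝ) * ΔT)
    -- exact propagator
    (E : ℝ → ℝ → B → B)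
    (hE_id : ∀ t, 0 ≤ t → t ≤ T → E t t = id)
    (hE_comp : ∀ s t, 0 ≤ s → s ≤ t → t ≤ T → (E s t) ∘ (E 0 s) = E 0 t)
    -- initial condition, discrete propagators and their defects
    (y₀ : B) (F G : ℕ → B → B) (δF δG : ℕ → B → B)
    (hδF : ∀ n < N, ∀ x : B, δF n x = E (Tg n) (Tg (n + 1)) x - F n x)
    (hδG : ∀ n < N, ∀ x : B, δG n x = E (Tg n) (Tg (n + 1)) x - G n x)
    -- constants
    (C η ε : ℝ) (hC : 0 < C) (hη : 0 ≤ η) (hε : 0 ≤ ε)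
    -- (H2) coarse Lipschitz bound
    (H2 : ∀ j ≤ M, ∀ n < N, ∀ x y : B,
      nrm j (G n x - G n y) ≤ (1 + C * ΔT) * nrm j (x - y))
    -- (H3) fine defect bound
    (H3 : ∀ j, j + 1 ≤ M → ∀ n < N, ∀ x y : B,
      nrm j (δF n x - δF n y) ≤ C * ΔT * η * nrm (j + 1) (x - y))
    (H3' : ∀ n < N, δF n 0 = 0)
    -- (H4) coarse defect bound
    (H4 : ∀ j, j + 1 ≤ M → ∀ n < N, ∀ x y : B,
      nrm j (δG n x - δG n y) ≤ C * ΔT * ε * nrm (j + 1) (x - y))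
    (H4' : ∀ n < N, δG n 0 = 0)
    -- parareal iterates : `Y k n` is `Y_n^k`
    (Y : ℕ → ℕ → B)
    (hY0 : ∀ k, Y k 0 = y₀)
    (hYcoarse : ∀ n < N, Y 0 (n + 1) = G n (Y 0 n))
    (hYrec : ∀ k, ∀ n < N,
      Y (k + 1) (n + 1) = G n (Y (k + 1) n) + F n (Y k n) - G n (Y k n)) :
    ∀ i j, i + 1 ≤ M → ∀ n, n + 1 ≤ N →
      nrm i (Y (j + 1) (n + 1) - E 0 (Tg (n + 1)) y₀) ≤
        (1 + C * ΔT) * nrm i (Y (j + 1) n - E 0 (Tg n) y₀)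
        + C * ΔT * ε * nrm (i + 1) (Y j n - E 0 (Tg n) y₀)
        + C * ΔT * η * nrm (i + 1) (Y j n - E 0 (Tg n) y₀)
        + C * ΔT * η * nrm (i + 1) (E 0 (Tg n) y₀) := by
  intro i j hi n hn
  have hnN : n < N := hn
  have hiM : i ≤ M := by omega
  have hneg : ∀ x : B, nrm (i + 1) (-x) = nrm (i + 1) x := fun x => by
    simpa using hnrm_smul (i + 1) hi (-1) x
  have hΔT0 : 0 ≤ ΔT := by rw [hΔT]; positivity
  have hlast : Tg (n + 1) ≤ T := by
    have hNT : (N : ℝ) * ΔT = T := by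
      rw [hΔT]
      field_simp
    have hle : ((n + 1 : ℕ) : ℝ) ≤ N := by exact_mod_cast hn
    rw [hTg, ← hNT]
    gcongr
  have hfirst : 0 ≤ Tg n := by rw [hTg]; positivity
  have hstep : Tg n ≤ Tg (n + 1) := by
    rw [hTg, hTg]
    gcongr
    omega
  set y := E 0 (Tg n) y₀
  have hexact : E 0 (Tg (n + 1)) y₀ = E (Tg n) (Tg (n + 1)) y :=
    (congrFun (hE_comp (Tg n) (Tg (n + 1)) hfirst hstep hlast) y₀).symm
  have hsplit : Y (j + 1) (n + 1) - E 0 (Tg (n + 1)) y₀ =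
      (G n (Y (j + 1) n) - G n y) + (δG n (Y j n) - δG n y)
        + (δF n y - δF n (Y j n)) + (δF n 0 - δF n y) := by
    rw [hexact, hYrec j n hnN, H3' n hnN, hδG n hnN, hδG n hnN, hδF n hnN (Y j n)]
    abel
  have hfine := H3 i hi n hnN y (Y j n)
  rw [← neg_sub (Y j n) y, hneg] at hfine
  have hfine₀ := H3 i hi n hnN 0 y
  rw [zero_sub y, hneg] at hfine₀
  rw [hsplit]
  refine (hnrm_add i hiM _ _).trans (add_le_add ?_ hfine₀)
  refine (hnrm_add i hiM _ _).trans (add_le_add ?_ ?_)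
  · exact (hnrm_add i hiM _ _).trans
      (add_le_add (H2 i hiM n hnN _ _) (H4 i hi n hnN _ _))
  · exact hfine
end

section
/- One-step stability of the parareal algorithm with groupwise projection. Let X be a Hilbert space, P_1,…,P_I : X → X continuous linear maps with Σ_{i=1}^I ‖P_i v‖² = ‖v‖² for every v ∈ X, and F : X → X a map satisfying ‖F(v)‖ ≤ (1 + αΔT)‖v‖ for all v ∈ X, where α ≥ 0 and ΔT > 0. If u, v, w ∈ X with u ≠ 0 satisfy ‖P_i w‖ = (‖P_i F(u)‖ / ‖u‖)·‖v‖ for every i = 1,…,I, then ‖w‖ ≤ (1 + αΔT)‖v‖. -/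
/-- One-step stability of the parareal algorithm with groupwise projection:
if `P₁, …, P_I` satisfy `Σᵢ ‖Pᵢ v‖² = ‖v‖²`, the fine propagator satisfies
`‖F(v)‖ ≤ (1 + αΔT)‖v‖`, and the projected update `w` satisfies
`‖Pᵢ w‖ = (‖Pᵢ F(u)‖/‖u‖) ‖v‖` for every `i`, then `‖w‖ ≤ (1 + αΔT)‖v‖`. -/
theorem groupwise_projected_parareal_one_step_stability
    {𝕜 : Type*} [RCLike 𝕜]
    {X : Type*} [NormedAddCommGroup X] [InnerProductSpace 𝕜 X] [CompleteSpace X]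
    (I : ℕ) (P : Fin I → X →L[𝕜] X)
    (hP : ∀ v : X, ∑ i : Fin I, ‖P i v‖ ^ 2 = ‖v‖ ^ 2)
    (F : X → X) (α ΔT : ℝ) (hα : 0 ≤ α) (hΔT : 0 < ΔT)
    (hF : ∀ v : X, ‖F v‖ ≤ (1 + α * ΔT) * ‖v‖)
    (u v w : X) (hu : u ≠ 0)
    (hw : ∀ i : Fin I, ‖P i w‖ = (‖P i (F u)‖ / ‖u‖) * ‖v‖) :
    ‖w‖ ≤ (1 + α * ΔT) * ‖v‖ := by
  have norm_w : ‖w‖ = ‖F u‖ / ‖u‖ * ‖v‖ := by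
    rw [← sq_eq_sq₀ (by positivity) (by positivity), ← hP w]
    simp_rw [hw, mul_pow, div_pow]
    rw [← Finset.sum_mul, ← Finset.sum_div, hP]
  rw [norm_w]
  gcongr
  exact (div_le_iff₀ (norm_pos_iff.mpr hu)).mpr (hF u)
end

section
/- Global stability of the parareal algorithm with groupwise projection. Let X be a Hilbert space, P_1,…,P_I : X → X continuous linear maps with Σ_{i=1}^I ‖P_i v‖² = ‖v‖² for every v ∈ X, and F : X → X a map satisfying ‖F(v)‖ ≤ (1 + αΔT)‖v‖ for all v ∈ X, with α ≥ 0, ΔT > 0. Let u_0 ∈ X and let (u_n^k) for 0 ≤ n ≤ N, k ≥ 0 be elements of X with u_0^k = u_0 for all k, u_n^k ≠ 0 for all n < N and k, and satisfying for all n < N and k ≥ 0: ‖P_i u_{n+1}^{k+1}‖ = (‖P_i F(u_n^k)‖ / ‖u_n^k‖)·‖u_n^{k+1}‖ for every i = 1,…,I. Then for every k ≥ 1 and every n ≤ N, ‖u_n^k‖ ≤ (1 + αΔT)^n ‖u_0‖; in particular, if N·ΔT = T then ‖u_n^k‖ ≤ e^{αT} ‖u_0‖ for all n ≤ N and k ≥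 1. -/
/-- If the square norms of the components `f i v` add up to that of `v`, then a vector whose
components have `c` times the norms of the components of `w` has norm `c * ‖w‖`. -/
theorem norm_eq_mul_norm_of_forall_component_norm_eq {ι E : Type*} [Fintype ι]
    [SeminormedAddCommGroup E] {f : ι → E → E}
    (hf : ∀ v : E, ∑ i, ‖f i v‖ ^ 2 = ‖v‖ ^ 2) {c : ℝ} (hc : 0 ≤ c) {v w : E}
    (h : ∀ i, ‖f i v‖ = c * ‖f i w‖) : ‖v‖ = c * ‖w‖ := by
  refine (sq_eq_sq₀ (norm_nonneg v) (by positivity)).mp ?_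
  rw [mul_pow, ← hf v, ← hf w, Finset.mul_sum]
  simp only [h, mul_pow]


/-- Global stability of the parareal algorithm with groupwise projection: if the
projected iterates satisfy `‖Pᵢ u_{n+1}^{k+1}‖ = (‖Pᵢ F(u_n^k)‖/‖u_n^k‖) ‖u_n^{k+1}‖`
for every group `i`, with `Σᵢ ‖Pᵢ v‖² = ‖v‖²` and `‖F(v)‖ ≤ (1 + αΔT)‖v‖`, then
`‖u_n^k‖ ≤ (1 + αΔT)ⁿ ‖u₀‖` for every `k ≥ 1`, `n ≤ N`; in particular if `NΔT = T`
then `‖u_n^k‖ ≤ e^{αT} ‖u₀‖`. -/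
theorem groupwise_projected_parareal_global_stability
    {𝕜 : Type*} [RCLike 𝕜]
    {X : Type*} [NormedAddCommGroup X] [InnerProductSpace 𝕜 X] [CompleteSpace X]
    (I : ℕ) (P : Fin I → X →L[𝕜] X)
    (hP : ∀ v : X, ∑ i : Fin I, ‖P i v‖ ^ 2 = ‖v‖ ^ 2)
    (F : X → X) (α ΔT : ℝ) (hα : 0 ≤ α) (hΔT : 0 < ΔT)
    (hF : ∀ v : X, ‖F v‖ ≤ (1 + α * ΔT) * ‖v‖)
    (N : ℕ) (u₀ : X)
    (u : ℕ → ℕ → X)  -- `u k n` is `u_n^k`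
    (hu0 : ∀ k, u k 0 = u₀)
    (hune : ∀ k, ∀ n < N, u k n ≠ 0)
    (hurec : ∀ k, ∀ n < N, ∀ i : Fin I,
      ‖P i (u (k + 1) (n + 1))‖ = (‖P i (F (u k n))‖ / ‖u k n‖) * ‖u (k + 1) n‖) :
    (∀ k, 1 ≤ k → ∀ n ≤ N, ‖u k n‖ ≤ (1 + α * ΔT) ^ n * ‖u₀‖)
      ∧ ∀ T : ℝ, (N : ℝ) * ΔT = T →
          ∀ k, 1 ≤ k → ∀ n ≤ N, ‖u k n‖ ≤ Real.exp (α * T) * ‖u₀‖ := by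
  have growth : ∀ k, ∀ n < N, ‖u (k + 1) (n + 1)‖ ≤ (1 + α * ΔT) * ‖u (k + 1) n‖ := by
    intro k n hn
    have hpos : 0 < ‖u k n‖ := norm_pos_iff.mpr (hune k n hn)
    have hnorm : ‖u (k + 1) (n + 1)‖ = ‖u (k + 1) n‖ / ‖u k n‖ * ‖F (u k n)‖ :=
      norm_eq_mul_norm_of_forall_component_norm_eq (f := fun i => P i) hP (by positivity)
        fun i => by rw [hurec k n hn i]; ring
    calc ‖u (k + 1) (n + 1)‖
        = ‖u (k + 1) n‖ / ‖u k n‖ * ‖F (u k n)‖ := hnorm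
      _ ≤ ‖u (k + 1) n‖ / ‖u k n‖ * ((1 + α * ΔT) * ‖u k n‖) := by gcongr; exact hF _
      _ = (1 + α * ΔT) * ‖u (k + 1) n‖ := by field_simp
  have bound : ∀ k, 1 ≤ k → ∀ n ≤ N, ‖u k n‖ ≤ (1 + α * ΔT) ^ n * ‖u₀‖ := by
    intro k hk n hn
    obtain ⟨k, rfl⟩ := Nat.exists_eq_add_of_le' hk
    rw [← hu0 (k + 1), mul_comm]
    induction n with
    | zero => simp
    | succ n ih =>
      calc ‖u (k + 1) (n + 1)‖
          ≤ (1 + α * ΔT) * ‖u (k + 1) n‖ := growth k n hn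
        _ ≤ (1 + α * ΔT) * (‖u (k + 1) 0‖ * (1 + α * ΔT) ^ n) := by
          gcongr; exact ih (by lia)
        _ = ‖u (k + 1) 0‖ * (1 + α * ΔT) ^ (n + 1) := by ring
  refine ⟨bound, ?_⟩
  rintro T rfl k hk n hn
  refine (bound k hk n hn).trans ?_
  gcongr
  calc (1 + α * ΔT) ^ n
      ≤ (1 + α * ΔT) ^ N := pow_le_pow_right₀ (le_add_of_nonneg_right (by positivity)) hn
    _ ≤ Real.exp (α * ΔT) ^ N := by
      gcongr; rw [add_comm]; exact Real.add_one_le_exp _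
    _ = Real.exp (α * (N * ΔT)) := by rw [← Real.exp_nat_mul]; ring_nf
end
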